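/- arXiv:math/0105180 — 2 statements merged into one kernel-verified Lean document; each statement's English description precedes it below -/
import Mathlib

section
/- Let n ≥ 4, a > 0, r > 0 with a² ≠ 2 and γ ≠ 3, where γ := a²(n−1)/(a²+n−3). Consider the 2n−2 centers c_1=(1,1,1,0,…,0), c_2=(1,−1,−1,0,…,0), c_3=(−1,1,−1,0,…,0), c_4=(−1,−1,1,0,…,0), and ±a·e_j for j = 4,…,n in ℝ^n. Suppose p ∈ ℂ^n and v ∈ ℂ^n with v ≠ 0, v·v ≠ 0 and p·v = 0 satisfy the tangency equation (v·(p−c))² = (v·v)·((p−c)² − r²) for every center c, and suppose v_1 = 0. Then (3−γ)·(v·v) = v_2² + v_3² and p_1² = r² − γ. -/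
open scoped BigOperators

/-- The bilinear (conjugation-free) dot product on `ℂⁿ`. -/
noncomputable def dotc {n : ℕ} (x y : Fin n → ℂ) : ℂ := ∑ i, x i * y i

/-- The standard inclusion `ℝⁿ ⊆ ℂⁿ`. -/
def toC {n : ℕ} (c : Fin n → ℝ) : Fin n → ℂ := fun j => (c j : ℂ)

/-- The tetrahedron vertex `(1,1,1,0,…,0)` of `ℝⁿ`. -/
def tetraA (n : ℕ) : Fin n → ℝ := fun i =>
  if i.val = 0 then 1 else if i.val = 1 then 1 else if i.val = 2 then 1 else 0

/-- The tetrahedron vertex `(1,−1,−1,0,…,0)` of `ℝⁿ`. -/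
def tetraB (n : ℕ) : Fin n → ℝ := fun i =>
  if i.val = 0 then 1 else if i.val = 1 then -1 else if i.val = 2 then -1 else 0

/-- The tetrahedron vertex `(−1,1,−1,0,…,0)` of `ℝⁿ`. -/
def tetraC (n : ℕ) : Fin n → ℝ := fun i =>
  if i.val = 0 then -1 else if i.val = 1 then 1 else if i.val = 2 then -1 else 0

/-- The tetrahedron vertex `(−1,−1,1,0,…,0)` of `ℝⁿ`. -/
def tetraD (n : ℕ) : Fin n → ℝ := fun i =>
  if i.val = 0 then -1 else if i.val = 1 then -1 else if i.val = 2 then 1 else 0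

/-- The `2n−2` centers: the four tetrahedron vertices together with `±a·eⱼ` for
`j = 4,…,n` (in 1-based indexing; `3 ≤ j.val` in the 0-based indexing of `Fin n`). -/
def configCenters (n : ℕ) (a : ℝ) : Set (Fin n → ℝ) :=
  {tetraA n, tetraB n, tetraC n, tetraD n} ∪
    {x | ∃ j : Fin n, 3 ≤ j.val ∧
      (x = a • (Pi.single j 1 : Fin n → ℝ) ∨ x = -(a • (Pi.single j 1 : Fin n → ℝ)))}

theorem dotc_comm {n : ℕ} (x y : Fin n → ℂ) : dotc x y = dotc y x := by
  simp only [dotc, mul_comm]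

theorem dotc_sub_right {n : ℕ} (x y z : Fin n → ℂ) : dotc x (y - z) = dotc x y - dotc x z := by
  simp only [dotc, Pi.sub_apply, mul_sub, Finset.sum_sub_distrib]

theorem dotc_sub_self {n : ℕ} (x y : Fin n → ℂ) :
    dotc (x - y) (x - y) = dotc x x - 2 * dotc x y + dotc y y := by
  simp only [dotc, Pi.sub_apply, Finset.mul_sum, ← Finset.sum_sub_distrib,
    ← Finset.sum_add_distrib]
  exact Finset.sum_congr rfl fun _ _ => by ring

/-- Tangency to a sphere, written in terms of the squared norms and inner products. -/
theorem tangent_iff_of_dotc_eq_zero {n : ℕ} {p v : Fin n → ℂ} (hpv : dotc p v = 0)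
    (c : Fin n → ℂ) (s : ℂ) :
    dotc v (p - c) ^ 2 = dotc v v * (dotc (p - c) (p - c) - s) ↔
      dotc v c ^ 2 = dotc v v * (dotc p p - 2 * dotc p c + dotc c c - s) := by
  rw [dotc_sub_right, dotc_comm v p, hpv, dotc_sub_self, zero_sub, neg_sq]

theorem dotc_add_three {m : ℕ} (x y : Fin (m + 3) → ℂ) :
    dotc x y = x 0 * y 0 + x 1 * y 1 + x 2 * y 2 +
      ∑ i : Fin m, x i.succ.succ.succ * y i.succ.succ.succ := by
  simp only [dotc, Fin.sum_univ_succ, add_assoc]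
  rfl

theorem dotc_tetraA {m : ℕ} (x : Fin (m + 3) → ℂ) :
    dotc x (toC (tetraA (m + 3))) = x 0 + x 1 + x 2 := by
  rw [dotc_add_three]
  simp [toC, tetraA]

theorem dotc_tetraB {m : ℕ} (x : Fin (m + 3) → ℂ) :
    dotc x (toC (tetraB (m + 3))) = x 0 - x 1 - x 2 := by
  rw [dotc_add_three]
  simp [toC, tetraB, Nat.mod_eq_of_lt (show 2 < m + 3 by omega)]
  ring

theorem dotc_tetraC {m : ℕ} (x : Fin (m + 3) → ℂ) :
    dotc x (toC (tetraC (m + 3))) = -x 0 + x 1 - x 2 := by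
  rw [dotc_add_three]
  simp [toC, tetraC, Nat.mod_eq_of_lt (show 2 < m + 3 by omega)]
  ring

theorem dotc_tetraD {m : ℕ} (x : Fin (m + 3) → ℂ) :
    dotc x (toC (tetraD (m + 3))) = -x 0 - x 1 + x 2 := by
  rw [dotc_add_three]
  simp [toC, tetraD, Nat.mod_eq_of_lt (show 2 < m + 3 by omega)]
  ring

theorem dotc_tetraA_self (m : ℕ) :
    dotc (toC (tetraA (m + 3))) (toC (tetraA (m + 3))) = 3 := by
  rw [dotc_tetraA]
  norm_num [toC, tetraA, Nat.mod_eq_of_lt (show 2 < m + 3 by omega)]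

theorem dotc_tetraB_self (m : ℕ) :
    dotc (toC (tetraB (m + 3))) (toC (tetraB (m + 3))) = 3 := by
  rw [dotc_tetraB]
  norm_num [toC, tetraB, Nat.mod_eq_of_lt (show 2 < m + 3 by omega)]

theorem dotc_tetraC_self (m : ℕ) :
    dotc (toC (tetraC (m + 3))) (toC (tetraC (m + 3))) = 3 := by
  rw [dotc_tetraC]
  norm_num [toC, tetraC, Nat.mod_eq_of_lt (show 2 < m + 3 by omega)]

theorem dotc_tetraD_self (m : ℕ) :
    dotc (toC (tetraD (m + 3))) (toC (tetraD (m + 3))) = 3 := by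
  rw [dotc_tetraD]
  norm_num [toC, tetraD, Nat.mod_eq_of_lt (show 2 < m + 3 by omega)]

theorem dotc_smul_single {n : ℕ} (x : Fin n → ℂ) (a : ℝ) (j : Fin n) :
    dotc x (toC (a • (Pi.single j 1 : Fin n → ℝ))) = a * x j := by
  rw [dotc, Finset.sum_eq_single j]
  · simp [toC, mul_comm]
  · intro i _ hij
    simp [toC, hij]
  · simp

theorem toC_neg {n : ℕ} (c : Fin n → ℝ) : toC (-c) = -toC c := by
  ext i; simp [toC]

theorem dotc_neg_right {n : ℕ} (x y : Fin n → ℂ) : dotc x (-y) = -dotc x y := by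
  simp [dotc]

/-- with `a² ≠ 2` and `γ ≠ 3`, if the line through `p` with nonzero
direction `v` (with `v·v ≠ 0`, `p·v = 0`) is tangent to every sphere of the
tetrahedron-plus-crosspolytope configuration and `v₁ = 0`, then
`(3−γ)·(v·v) = v₂² + v₃²` and `p₁² = r² − γ`. -/
theorem tangent_line_case_v1_zero (n : ℕ) (hn : 4 ≤ n) (a r : ℝ) (ha : 0 < a) (hr : 0 < r)
    (γ : ℝ) (hγ : γ = a ^ 2 * ((n : ℝ) - 1) / (a ^ 2 + (n : ℝ) - 3))
    (ha2 : a ^ 2 ≠ 2) (hγ3 : γ ≠ 3)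
    (p v : Fin n → ℂ) (hv : v ≠ 0) (hvv : dotc v v ≠ 0) (hpv : dotc p v = 0)
    (htan : ∀ c ∈ configCenters n a,
      dotc v (p - toC c) ^ 2 = dotc v v * (dotc (p - toC c) (p - toC c) - (r : ℂ) ^ 2))
    (hv1 : v ⟨0, by omega⟩ = 0) :
    ((3 : ℂ) - (γ : ℂ)) * dotc v v = v ⟨1, by omega⟩ ^ 2 + v ⟨2, by omega⟩ ^ 2 ∧
      p ⟨0, by omega⟩ ^ 2 = (r : ℂ) ^ 2 - (γ : ℂ) := by
  obtain ⟨m, rfl⟩ : ∃ m, n = m + 3 := ⟨n - 3, by omega⟩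
  change v 0 = 0 at hv1
  change ((3 : ℂ) - (γ : ℂ)) * dotc v v = v 1 ^ 2 + v 2 ^ 2 ∧ p 0 ^ 2 = (r : ℂ) ^ 2 - (γ : ℂ)
  simp only [tangent_iff_of_dotc_eq_zero hpv] at htan
  have haC : (a : ℂ) ≠ 0 := by exact_mod_cast ha.ne'
  have hA := htan (tetraA _) (by simp [configCenters])
  have hB := htan (tetraB _) (by simp [configCenters])
  have hC := htan (tetraC _) (by simp [configCenters])
  have hD := htan (tetraD _) (by simp [configCenters])
  have hpos (j : Fin m) := htan (a • Pi.single j.succ.succ.succ 1)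
    (Or.inr ⟨j.succ.succ.succ, by simp, Or.inl rfl⟩)
  have hneg (j : Fin m) := htan (-(a • Pi.single j.succ.succ.succ 1))
    (Or.inr ⟨j.succ.succ.succ, by simp, Or.inr rfl⟩)
  rw [dotc_tetraA_self, dotc_tetraA, dotc_tetraA, hv1] at hA
  rw [dotc_tetraB_self, dotc_tetraB, dotc_tetraB, hv1] at hB
  rw [dotc_tetraC_self, dotc_tetraC, dotc_tetraC, hv1] at hC
  rw [dotc_tetraD_self, dotc_tetraD, dotc_tetraD, hv1] at hD
  simp only [toC_neg, dotc_neg_right, dotc_comm (-toC _), dotc_smul_single] at hpos hneg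
  simp [toC] at hpos hneg
  have hp (j : Fin m) : p j.succ.succ.succ = 0 := by
    refine (mul_eq_zero.mp ?_).resolve_left (mul_ne_zero hvv haC)
    linear_combination (hpos j - hneg j) / 4
  have hp12 : p 1 + p 2 = 0 :=
    (mul_eq_zero.mp (by linear_combination (hA - hB) / 4 :
      dotc v v * (p 1 + p 2) = 0)).resolve_left hvv
  have hp12' : p 1 - p 2 = 0 :=
    (mul_eq_zero.mp (by linear_combination (hC - hD) / 4 :
      dotc v v * (p 1 - p 2) = 0)).resolve_left hvv
  have hp1 : p 1 = 0 := by linear_combination (hp12 + hp12') / 2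
  have hp2 : p 2 = 0 := by linear_combination (hp12 - hp12') / 2
  have hpp : dotc p p = p 0 ^ 2 := by
    rw [dotc_add_three]; simp [hp, hp1, hp2, sq]
  have hsum : (a : ℂ) ^ 2 * ∑ j : Fin m, v j.succ.succ.succ * v j.succ.succ.succ =
      m * (dotc v v * (p 0 ^ 2 + a ^ 2 - r ^ 2)) := by
    rw [Finset.mul_sum, Finset.sum_congr rfl (g := fun _ =>
      dotc v v * (p 0 ^ 2 + a ^ 2 - r ^ 2))]
    · simp
    · intro j _
      have := hpos j
      rw [hp j, hpp] at this
      linear_combination this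
  have hK : v 1 ^ 2 + v 2 ^ 2 = dotc v v * (p 0 ^ 2 + 3 - r ^ 2) := by
    rw [hpp] at hA hC
    linear_combination (hA + hC) / 2 - 2 * dotc v v * hp1
  have hvS := dotc_add_three v v
  have hden : (0 : ℝ) < a ^ 2 + m := by positivity
  have hdenC : (a : ℂ) ^ 2 + m ≠ 0 := by exact_mod_cast hden.ne'
  have hγC : (γ : ℂ) * (a ^ 2 + m) = a ^ 2 * (m + 2) := by
    have : γ * (a ^ 2 + m) = a ^ 2 * (m + 2) := by
      rw [hγ]
      push_cast
      rw [show a ^ 2 + ((m : ℝ) + 3) - 3 = a ^ 2 + m by ring, div_mul_cancel₀ _ hden.ne']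
      ring
    exact_mod_cast this
  have hp0 : p 0 ^ 2 = (r : ℂ) ^ 2 - γ := by
    refine mul_left_cancel₀ (mul_ne_zero hvv hdenC) ?_
    rw [hv1] at hvS
    linear_combination (-a ^ 2 : ℂ) * hvS - hsum - (a : ℂ) ^ 2 * hK + dotc v v * hγC
  refine ⟨?_, hp0⟩
  rw [hK, hp0]
  ring
end

section
/- For every n ≥ 4 there exist points c_1, …, c_{2n−2} ∈ ℝ^n all lying in a common affine hyperplane (so in particular affinely dependent) and a radius r > 0 such that the set of one-dimensional affine subspaces L of ℂ^n tangent to all 2n−2 spheres with centers c_i and radius r (i.e. satisfying (v·(p−c_i))² = (v·v)·((p−c_i)² − r²) for some p ∈ L and nonzero direction v of L, for each i) is finite with exactly 3·2^{n−1} elements. -/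
open scoped BigOperators

/-- A one-dimensional affine subspace `L ⊆ ℂⁿ` is tangent to the sphere with center `c`
and radius `r` when for some point `p ∈ L` and nonzero direction vector `v` of `L` one has
`(v·(p−c))² = (v·v)·((p−c)² − r²)`. -/
def IsTangentLine {n : ℕ} (L : AffineSubspace ℂ (Fin n → ℂ)) (c : Fin n → ℂ) (r : ℝ) : Prop :=
  ∃ p ∈ L, ∃ v ∈ L.direction, v ≠ 0 ∧
    dotc v (p - c) ^ 2 = dotc v v * (dotc (p - c) (p - c) - (r : ℂ) ^ 2)

open Matrix

section Tangency

variable {n : ℕ}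

lemma dotc_eq_dotProduct (x y : Fin n → ℂ) : dotc x y = x ⬝ᵥ y := rfl

/-- Tangency may be tested at any point and any direction vector of the line. -/
lemma isTangentLine_iff {L : AffineSubspace ℂ (Fin n → ℂ)} {p v c : Fin n → ℂ} {r : ℝ}
    (hp : p ∈ L) (hv : v ≠ 0) (hL : L.direction = Submodule.span ℂ {v}) :
    IsTangentLine L c r ↔
      (v ⬝ᵥ (p - c)) ^ 2 = (v ⬝ᵥ v) * ((p - c) ⬝ᵥ (p - c) - (r : ℂ) ^ 2) := by
  constructor
  · rintro ⟨p', hp', v', hv', hv'0, h⟩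
    simp only [dotc_eq_dotProduct] at h
    rw [hL, Submodule.mem_span_singleton] at hv'
    obtain ⟨t, rfl⟩ := hv'
    have hd : p' -ᵥ p ∈ L.direction := AffineSubspace.vsub_mem_direction hp' hp
    rw [hL, Submodule.mem_span_singleton] at hd
    obtain ⟨s, hs⟩ := hd
    have ht : t ≠ 0 := by rintro rfl; simp at hv'0
    have hpc : p' - c = (p - c) + s • v := by
      rw [hs, vsub_eq_sub]; abel
    rw [hpc] at h
    generalize p - c = x at h ⊢
    simp only [dotProduct_add, add_dotProduct, smul_dotProduct, dotProduct_smul, smul_eq_mul,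
      dotProduct_comm x v] at h
    refine mul_left_cancel₀ (pow_ne_zero 2 ht) ?_
    linear_combination h
  · intro h
    exact ⟨p, hp, v, hL ▸ Submodule.mem_span_singleton_self v, hv, h⟩

/-- The tangency condition for a center on a coordinate axis and normalized line data. -/
lemma tangency_single_iff {p v : Fin n → ℂ} (hvv : v ⬝ᵥ v = 1) (hvp : v ⬝ᵥ p = 0)
    (i : Fin n) (x r : ℂ) :
    (v ⬝ᵥ (p - Pi.single i x)) ^ 2 =
        (v ⬝ᵥ v) * ((p - Pi.single i x) ⬝ᵥ (p - Pi.single i x) - r ^ 2) ↔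
      x ^ 2 * (v i ^ 2 - 1) + 2 * x * p i + (r ^ 2 - p ⬝ᵥ p) = 0 := by
  simp only [hvv, dotProduct_sub, sub_dotProduct, hvp, dotProduct_single, single_dotProduct,
    Pi.sub_apply, Pi.single_eq_same]
  constructor <;> intro h <;> linear_combination h

end Tangency

/-- The coordinates of the centers on the coordinate axes: `2` and `-1/2` on the first axis,
`1` and `-1` on the others. -/
noncomputable def axisCoord {q : ℕ} (j : Fin (q + 1)) (s : Bool) : ℝ :=
  if j = 0 then (if s then 2 else -1 / 2) else (if s then 1 else -1)

/-- The centers, two on each of the first `q + 1` coordinate axes of `ℝ^(q+2)`. -/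
noncomputable def axisCenter {q : ℕ} (j : Fin (q + 1)) (s : Bool) : Fin (q + 2) → ℝ :=
  Pi.single j.castSucc (axisCoord j s)

lemma axisCenter_ofReal {q : ℕ} (j : Fin (q + 1)) (s : Bool) :
    (fun i => (axisCenter j s i : ℂ)) = Pi.single j.castSucc (axisCoord j s : ℂ) := by
  funext i
  by_cases h : i = j.castSucc
  · subst h; simp [axisCenter]
  · simp [axisCenter, h]

/-- The tangency conditions at the two centers of an axis, solved for `v j ^ 2` and `p j`. -/
lemma axis_equations_iff {q : ℕ} (j : Fin (q + 1)) (V P k : ℂ) :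
    (∀ s, (axisCoord j s : ℂ) ^ 2 * (V ^ 2 - 1) + 2 * (axisCoord j s : ℂ) * P + k = 0) ↔
      V ^ 2 = 1 - k ∧ P = if j = 0 then 3 / 4 * k else 0 := by
  by_cases hj : j = 0
  · simp only [axisCoord, hj, if_true, Bool.forall_bool]
    push_cast
    constructor
    · rintro ⟨h1, h2⟩
      norm_num at h1 h2
      constructor
      · linear_combination (4 / 5) * h1 + (1 / 5) * h2
      · linear_combination (-4 / 5) * h1 + (1 / 20) * h2
    · rintro ⟨h1, rfl⟩
      rw [h1]
      norm_num
      constructor <;> ring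
  · simp only [axisCoord, hj, if_false, Bool.forall_bool]
    push_cast
    constructor
    · rintro ⟨h1, h2⟩
      norm_num at h1 h2
      constructor
      · linear_combination (1 / 2) * h1 + (1 / 2) * h2
      · linear_combination (-1 / 4) * h1 + (1 / 4) * h2
    · rintro ⟨h1, rfl⟩
      rw [h1]
      norm_num

section Cubic

/-- The cubic whose roots are the possible values of `r² - p²` for a common tangent line. -/
noncomputable def tangentCubic {K : Type*} [Field K] (q : ℕ) (k : K) : K :=
  9 / 16 * k ^ 2 * (1 - k) - ((q + 1) * k - q) * (4 - k - 9 / 16 * k ^ 2)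

lemma continuous_tangentCubic (q : ℕ) : Continuous (tangentCubic q : ℝ → ℝ) := by
  unfold tangentCubic
  fun_prop

lemma exists_real_roots_tangentCubic {q : ℕ} (hq : 2 ≤ q) :
    ∃ x y z : ℝ, x < y ∧ y < z ∧
      tangentCubic q x = 0 ∧ tangentCubic q y = 0 ∧ tangentCubic q z = 0 := by
  have hq' : (2 : ℝ) ≤ q := by exact_mod_cast hq
  have h6 : tangentCubic q (-6 : ℝ) < 0 := by unfold tangentCubic; linarith
  have h0 : 0 < tangentCubic q (0 : ℝ) := by unfold tangentCubic; linarith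
  have h1 : tangentCubic q (1 : ℝ) < 0 := by unfold tangentCubic; linarith
  have h3 : 0 < tangentCubic q (3 : ℝ) := by unfold tangentCubic; linarith
  have hc := continuous_tangentCubic q
  obtain ⟨x, hx, hx0⟩ := intermediate_value_Ioo (by norm_num : (-6 : ℝ) ≤ 0) hc.continuousOn
    (Set.mem_Ioo.2 ⟨h6, h0⟩)
  obtain ⟨y, hy, hy0⟩ := intermediate_value_Ioo' (by norm_num : (0 : ℝ) ≤ 1) hc.continuousOn
    (Set.mem_Ioo.2 ⟨h1, h0⟩)
  obtain ⟨z, hz, hz0⟩ := intermediate_value_Ioo (by norm_num : (1 : ℝ) ≤ 3) hc.continuousOn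
    (Set.mem_Ioo.2 ⟨h1, h3⟩)
  exact ⟨x, y, z, hx.2.trans hy.1, hy.2.trans hz.1, hx0, hy0, hz0⟩

lemma ofReal_tangentCubic (q : ℕ) (x : ℝ) :
    ((tangentCubic q x : ℝ) : ℂ) = tangentCubic q (x : ℂ) := by
  unfold tangentCubic
  push_cast
  ring

/-- A cubic with three distinct roots is the product of the corresponding linear factors. -/
lemma cubic_eq_prod_of_roots {K : Type*} [Field K] {a b c d x y z : K} (hxy : x ≠ y)
    (hyz : y ≠ z) (hxz : x ≠ z)
    (hx : a * x ^ 3 + b * x ^ 2 + c * x + d = 0)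
    (hy : a * y ^ 3 + b * y ^ 2 + c * y + d = 0)
    (hz : a * z ^ 3 + b * z ^ 2 + c * z + d = 0) (t : K) :
    a * t ^ 3 + b * t ^ 2 + c * t + d = a * ((t - x) * (t - y) * (t - z)) := by
  have h1 : a * (x ^ 2 + x * y + y ^ 2) + b * (x + y) + c = 0 :=
    mul_left_cancel₀ (sub_ne_zero.2 hxy) (by linear_combination hx - hy)
  have h2 : a * (x ^ 2 + x * z + z ^ 2) + b * (x + z) + c = 0 :=
    mul_left_cancel₀ (sub_ne_zero.2 hxz) (by linear_combination hx - hz)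
  have h3 : a * (x + y + z) + b = 0 :=
    mul_left_cancel₀ (sub_ne_zero.2 hyz) (by linear_combination h1 - h2)
  linear_combination hx + (t - x) * h1 + (t - x) * (t - y) * h3

lemma exists_roots_tangentCubic {q : ℕ} (hq : 2 ≤ q) :
    ∃ k : Fin 3 → ℂ, Function.Injective k ∧
      ∀ t : ℂ, tangentCubic q t = 0 ↔ ∃ i, t = k i := by
  obtain ⟨x, y, z, hxy, hyz, hx, hy, hz⟩ := exists_real_roots_tangentCubic hq
  have expand : ∀ t : ℂ, tangentCubic q t = (9 / 16 * q) * t ^ 3 +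
      (9 / 16 - 9 / 16 * q + 1 + q) * t ^ 2 + (-(q + 4 * (q + 1))) * t + 4 * q := by
    intro t
    unfold tangentCubic
    ring
  have hxy' : (x : ℂ) ≠ y := by exact_mod_cast hxy.ne
  have hyz' : (y : ℂ) ≠ z := by exact_mod_cast hyz.ne
  have hxz' : (x : ℂ) ≠ z := by exact_mod_cast (hxy.trans hyz).ne
  have root : ∀ {s : ℝ}, tangentCubic q s = 0 → tangentCubic q (s : ℂ) = 0 := by
    intro s hs
    rw [← ofReal_tangentCubic, hs, Complex.ofReal_zero]
  have hq0 : (9 / 16 * q : ℂ) ≠ 0 := by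
    have : (q : ℂ) ≠ 0 := by exact_mod_cast (by omega : q ≠ 0)
    simpa using this
  refine ⟨![x, y, z], ?_, fun t => ?_⟩
  · intro i j hij
    fin_cases i <;> fin_cases j <;> simp_all
  · rw [expand t, cubic_eq_prod_of_roots hxy' hyz' hxz' (expand x ▸ root hx)
      (expand y ▸ root hy) (expand z ▸ root hz) t]
    simp only [mul_eq_zero, hq0, false_or, sub_eq_zero, Fin.exists_fin_succ, Fin.exists_fin_zero]
    simp [or_assoc]

/-- At a root of the cubic, neither `v j ^ 2 = 1 - k` nor the square of the last coordinate of
`v` vanishes. -/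
lemma ne_zero_of_tangentCubic_eq_zero {q : ℕ} (hq : 2 ≤ q) {k : ℂ} (hk : tangentCubic q k = 0) :
    1 - k ≠ 0 ∧ (q + 1) * k - q ≠ 0 := by
  have h1 : 1 - k ≠ 0 := by
    intro h
    obtain rfl : k = 1 := by linear_combination -h
    norm_num [tangentCubic] at hk
  refine ⟨h1, fun h => ?_⟩
  have h0 : k ≠ 0 := by
    rintro rfl
    have : (q : ℂ) = 0 := by linear_combination -h
    have : q = 0 := by exact_mod_cast this
    omega
  rw [tangentCubic, h, zero_mul, sub_zero] at hk
  simp [h0, h1] at hk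

end Cubic

section Lines

variable {q : ℕ}

/-- The affine line through `p` with direction `v`. -/
noncomputable def lineThrough {n : ℕ} (p v : Fin n → ℂ) : AffineSubspace ℂ (Fin n → ℂ) :=
  AffineSubspace.mk' p (Submodule.span ℂ {v})

/-- The common tangent lines to the spheres of radius `2` about the centers. -/
def tangentLines (q : ℕ) : Set (AffineSubspace ℂ (Fin (q + 2) → ℂ)) :=
  {L | Module.finrank ℂ L.direction = 1 ∧
    ∀ j s, IsTangentLine L (fun i => ((axisCenter (q := q) j s i : ℝ) : ℂ)) 2}

lemma lineThrough_mem_tangentLines_iff {p v : Fin (q + 2) → ℂ} (hvv : v ⬝ᵥ v = 1)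
    (hvp : v ⬝ᵥ p = 0) :
    lineThrough p v ∈ tangentLines q ↔ ∀ j : Fin (q + 1),
      v j.castSucc ^ 2 = 1 - (4 - p ⬝ᵥ p) ∧
        p j.castSucc = if j = 0 then 3 / 4 * (4 - p ⬝ᵥ p) else 0 := by
  have hv : v ≠ 0 := by rintro rfl; simp at hvv
  have hdir : (lineThrough p v).direction = Submodule.span ℂ {v} :=
    AffineSubspace.direction_mk' _ _
  have hp : p ∈ lineThrough p v := AffineSubspace.self_mem_mk' _ _
  have hfin : Module.finrank ℂ (lineThrough p v).direction = 1 := by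
    rw [hdir, finrank_span_singleton hv]
  simp only [tangentLines, Set.mem_ofPred_eq, hfin, true_and]
  refine forall_congr' fun j => ?_
  rw [← axis_equations_iff]
  refine forall_congr' fun s => ?_
  rw [isTangentLine_iff hp hv hdir, axisCenter_ofReal, tangency_single_iff hvv hvp]
  norm_num

/-- A common tangent line has a non-isotropic direction. -/
lemma dotProduct_self_ne_zero_of_tangent {p v : Fin (q + 2) → ℂ} (hv : v ≠ 0)
    (h : ∀ (j : Fin (q + 1)) (s : Bool),
      (v ⬝ᵥ (p - Pi.single j.castSucc (axisCoord j s : ℂ))) ^ 2 =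
      (v ⬝ᵥ v) * ((p - Pi.single j.castSucc (axisCoord j s : ℂ)) ⬝ᵥ
        (p - Pi.single j.castSucc (axisCoord j s : ℂ)) - ((2 : ℝ) : ℂ) ^ 2)) :
    v ⬝ᵥ v ≠ 0 := by
  intro h0
  simp only [h0, zero_mul, sq_eq_zero_iff, dotProduct_sub, dotProduct_single] at h
  have hz : ∀ j : Fin (q + 1), v j.castSucc = 0 := by
    intro j
    have h1 := h j true
    have h2 := h j false
    by_cases hj : j = 0
    · simp only [axisCoord, hj, if_true] at h1 h2
      norm_num at h1 h2
      rw [hj, Fin.castSucc_zero]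
      linear_combination (2 / 5) * h2 - (2 / 5) * h1
    · simp only [axisCoord, hj, if_true, if_false] at h1 h2
      norm_num at h1 h2
      linear_combination (1 / 2) * h2 - (1 / 2) * h1
  apply hv
  rw [dotProduct, Fin.sum_univ_castSucc] at h0
  simp only [hz, mul_zero, Finset.sum_const_zero, zero_add, mul_self_eq_zero] at h0
  funext i
  induction i using Fin.lastCases with
  | last => exact h0
  | cast j => exact hz j

/-- Every common tangent line has a normalized direction and a point orthogonal to it. -/
lemma exists_normalized_of_mem_tangentLines {L : AffineSubspace ℂ (Fin (q + 2) → ℂ)}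
    (hL : L ∈ tangentLines q) :
    ∃ p v : Fin (q + 2) → ℂ, v ⬝ᵥ v = 1 ∧ v ⬝ᵥ p = 0 ∧ L = lineThrough p v := by
  obtain ⟨hfin, ht⟩ := hL
  obtain ⟨p, hp, -⟩ := ht 0 true
  obtain ⟨⟨v, hvL⟩, hv0, hspan⟩ := finrank_eq_one_iff'.1 hfin
  have hv : v ≠ 0 := by rintro rfl; exact hv0 rfl
  have hdir : L.direction = Submodule.span ℂ {v} := by
    refine le_antisymm (fun w hw => ?_) ?_
    · obtain ⟨t, ht⟩ := hspan ⟨w, hw⟩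
      exact Submodule.mem_span_singleton.2 ⟨t, congrArg Subtype.val ht⟩
    · rwa [Submodule.span_singleton_le_iff_mem]
  have hvv : v ⬝ᵥ v ≠ 0 := by
    refine dotProduct_self_ne_zero_of_tangent (p := p) hv fun j s => ?_
    rw [← axisCenter_ofReal]
    exact (isTangentLine_iff hp hv hdir).1 (ht j s)
  obtain ⟨z, hz⟩ := IsAlgClosed.exists_pow_nat_eq (v ⬝ᵥ v) (n := 2) two_pos
  have hz0 : z ≠ 0 := by rintro rfl; exact hvv (by rw [← hz]; norm_num)
  have hdir' : L.direction = Submodule.span ℂ {z⁻¹ • v} := by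
    rw [hdir, Submodule.span_singleton_smul_eq (IsUnit.mk0 _ (inv_ne_zero hz0))]
  refine ⟨p - ((z⁻¹ • v) ⬝ᵥ p) • (z⁻¹ • v), z⁻¹ • v, ?_, ?_, ?_⟩
  · rw [smul_dotProduct, dotProduct_smul, ← hz, smul_eq_mul, smul_eq_mul]
    field_simp
  · simp only [smul_dotProduct, dotProduct_sub, dotProduct_smul, ← hz, smul_eq_mul]
    field_simp
    ring
  · have hmem : p - ((z⁻¹ • v) ⬝ᵥ p) • (z⁻¹ • v) ∈ L := by
      have := AffineSubspace.vadd_mem_of_mem_direction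
        (L.direction.smul_mem (-((z⁻¹ • v) ⬝ᵥ p)) (L.direction.smul_mem z⁻¹ hvL)) hp
      rwa [vadd_eq_add, neg_smul, neg_add_eq_sub] at this
    rw [lineThrough, ← hdir', AffineSubspace.mk'_eq hmem]

/-- Two normalized presentations of the same line agree up to the sign of the direction. -/
lemma lineThrough_injective {n : ℕ} {p v p' v' : Fin n → ℂ} (hvv : v ⬝ᵥ v = 1) (hvp : v ⬝ᵥ p = 0)
    (hvv' : v' ⬝ᵥ v' = 1) (hvp' : v' ⬝ᵥ p' = 0) (h : lineThrough p v = lineThrough p' v') :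
    p = p' ∧ (v' = v ∨ v' = -v) := by
  have hdir := congrArg AffineSubspace.direction h
  simp only [lineThrough, AffineSubspace.direction_mk'] at hdir
  have hv' : v' ∈ Submodule.span ℂ {v} := hdir ▸ Submodule.mem_span_singleton_self v'
  obtain ⟨t, rfl⟩ := Submodule.mem_span_singleton.1 hv'
  have ht : t * t = 1 := by
    simpa [smul_dotProduct, dotProduct_smul, hvv] using hvv'
  have hp' : p' ∈ lineThrough p v := h ▸ AffineSubspace.self_mem_mk' _ _
  rw [lineThrough, AffineSubspace.mem_mk', Submodule.mem_span_singleton] at hp'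
  obtain ⟨s, hs⟩ := hp'
  have ht0 : t ≠ 0 := by rintro rfl; simp at ht
  have hs0 : s = 0 := by
    have h1 : v ⬝ᵥ p' = 0 := by
      simpa [smul_dotProduct, ht0] using hvp'
    have h2 := congrArg (fun w => v ⬝ᵥ w) hs
    simpa [dotProduct_smul, dotProduct_sub, hvv, hvp, h1] using h2
  constructor
  · rw [hs0, zero_smul, vsub_eq_sub] at hs
    exact (sub_eq_zero.1 hs.symm).symm
  · rcases mul_self_eq_one_iff.1 ht with rfl | rfl <;> simp

/-- The sign `±1` encoded by a Boolean. -/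
def boolSign (s : Bool) : ℂ := if s then 1 else -1

lemma boolSign_sq (s : Bool) : boolSign s ^ 2 = 1 := by
  cases s <;> simp [boolSign]

lemma boolSign_injective : Function.Injective boolSign := by
  intro s t h
  cases s <;> cases t <;> first | rfl | norm_num [boolSign] at h

/-- The direction with coordinates `± a` and last coordinate `d`. -/
def signedDirection (a d : ℂ) (σ : Fin (q + 1) → Bool) : Fin (q + 2) → ℂ :=
  Fin.snoc (α := fun _ => ℂ) (fun j => boolSign (σ j) * a) d

/-- The point of a tangent line orthogonal to its direction. -/
noncomputable def footPoint (k a d : ℂ) (σ : Fin (q + 1) → Bool) : Fin (q + 2) → ℂ :=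
  Fin.snoc (α := fun _ => ℂ) (fun j : Fin (q + 1) => if j = 0 then 3 / 4 * k else 0)
    (-(3 / 4 * k * (boolSign (σ 0) * a)) / d)

lemma dotProduct_succ (x y : Fin (q + 2) → ℂ) :
    x ⬝ᵥ y = (∑ j : Fin (q + 1), x j.castSucc * y j.castSucc) +
      x (Fin.last _) * y (Fin.last _) :=
  Fin.sum_univ_castSucc _

lemma signedDirection_dotProduct_self {k a d : ℂ} (ha : a ^ 2 = 1 - k)
    (hd : d ^ 2 = (q + 1) * k - q) (σ : Fin (q + 1) → Bool) :
    signedDirection a d σ ⬝ᵥ signedDirection a d σ = 1 := by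
  have h : ∀ j, boolSign (σ j) * a * (boolSign (σ j) * a) = 1 - k := by
    intro j
    linear_combination a ^ 2 * boolSign_sq (σ j) + ha
  simp only [dotProduct_succ, signedDirection, Fin.snoc_castSucc, Fin.snoc_last, h,
    Finset.sum_const, Finset.card_univ, Fintype.card_fin, nsmul_eq_mul]
  push_cast
  linear_combination hd

lemma signedDirection_dotProduct_footPoint {k a d : ℂ} (hd0 : d ≠ 0) (σ : Fin (q + 1) → Bool) :
    signedDirection a d σ ⬝ᵥ footPoint k a d σ = 0 := by
  simp only [dotProduct_succ, signedDirection, footPoint, Fin.snoc_castSucc, Fin.snoc_last,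
    mul_ite, mul_zero, Finset.sum_ite_eq', Finset.mem_univ, if_true]
  field_simp
  ring

lemma footPoint_dotProduct_self {k a d : ℂ} (hk : tangentCubic q k = 0) (ha : a ^ 2 = 1 - k)
    (hd : d ^ 2 = (q + 1) * k - q) (hd0 : d ≠ 0) (σ : Fin (q + 1) → Bool) :
    footPoint k a d σ ⬝ᵥ footPoint k a d σ = 4 - k := by
  simp only [dotProduct_succ, footPoint, Fin.snoc_castSucc, Fin.snoc_last,
    mul_ite, mul_zero, Finset.sum_ite_eq', Finset.mem_univ, if_true]
  have h : (boolSign (σ 0) * a) ^ 2 = 1 - k := by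
    rw [mul_pow, boolSign_sq, one_mul, ha]
  generalize boolSign (σ 0) * a = w at h ⊢
  have e : -(3 / 4 * k * w) / d * (-(3 / 4 * k * w) / d) = 4 - k - 9 / 16 * k ^ 2 := by
    rw [div_mul_div_comm, div_eq_iff (mul_ne_zero hd0 hd0)]
    unfold tangentCubic at hk
    linear_combination hk + 9 / 16 * k ^ 2 * h - (4 - k - 9 / 16 * k ^ 2) * hd
  rw [e]
  ring

/-- The common tangent lines are parametrized by a root of the cubic and a choice of signs. -/
lemma exists_parametrization_tangentLines (hq : 2 ≤ q) :
    ∃ F : Fin 3 × (Fin (q + 1) → Bool) → AffineSubspace ℂ (Fin (q + 2) → ℂ),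
      Function.Injective F ∧ Set.range F = tangentLines q := by
  obtain ⟨k, hkinj, hk⟩ := exists_roots_tangentCubic hq
  have hroot : ∀ i, tangentCubic q (k i) = 0 := fun i => (hk _).2 ⟨i, rfl⟩
  choose a ha using fun i => IsAlgClosed.exists_pow_nat_eq (1 - k i) (n := 2) two_pos
  choose d hd using fun i => IsAlgClosed.exists_pow_nat_eq ((q + 1) * k i - q) (n := 2) two_pos
  have ha0 : ∀ i, a i ≠ 0 := fun i h => (ne_zero_of_tangentCubic_eq_zero hq (hroot i)).1
    (by rw [← ha, h]; norm_num)
  have hd0 : ∀ i, d i ≠ 0 := fun i h => (ne_zero_of_tangentCubic_eq_zero hq (hroot i)).2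
    (by rw [← hd, h]; norm_num)
  have hvv := fun i σ => signedDirection_dotProduct_self (q := q) (ha i) (hd i) σ
  have hvp := fun i σ =>
    signedDirection_dotProduct_footPoint (q := q) (k := k i) (a := a i) (hd0 i) σ
  have hpp := fun i σ => footPoint_dotProduct_self (hroot i) (ha i) (hd i) (hd0 i) σ
  refine ⟨fun x => lineThrough (footPoint (k x.1) (a x.1) (d x.1) x.2)
    (signedDirection (a x.1) (d x.1) x.2), ?_, Set.Subset.antisymm ?_ ?_⟩
  · rintro ⟨i, σ⟩ ⟨i', σ'⟩ h
    obtain ⟨hpeq, hveq⟩ := lineThrough_injective (hvv i σ) (hvp i σ) (hvv i' σ') (hvp i' σ') h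
    obtain rfl : i = i' := by
      apply hkinj
      have h1 := hpp i σ
      rw [hpeq, hpp] at h1
      linear_combination h1
    have hv : signedDirection (a i) (d i) σ' = signedDirection (a i) (d i) σ := by
      refine hveq.resolve_right fun hneg => hd0 i ?_
      have h1 := congrFun hneg (Fin.last _)
      simp only [signedDirection, Pi.neg_apply, Fin.snoc_last] at h1
      linear_combination h1 / 2
    refine Prod.ext rfl (funext fun j => ?_)
    have h1 := congrFun hv j.castSucc
    simp only [signedDirection, Fin.snoc_castSucc] at h1
    exact (boolSign_injective (mul_right_cancel₀ (ha0 i) h1)).symm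
  · rintro _ ⟨⟨i, σ⟩, rfl⟩
    rw [lineThrough_mem_tangentLines_iff (hvv i σ) (hvp i σ)]
    intro j
    simp only [hpp, sub_sub_cancel]
    simp only [signedDirection, footPoint, Fin.snoc_castSucc, and_true]
    rw [mul_pow, boolSign_sq, one_mul, ha]
  · intro L hL
    obtain ⟨p, v, hv1, hv2, rfl⟩ := exists_normalized_of_mem_tangentLines hL
    have hsys := (lineThrough_mem_tangentLines_iff hv1 hv2).1 hL
    obtain ⟨t, ht⟩ : ∃ t, t = 4 - p ⬝ᵥ p := ⟨_, rfl⟩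
    rw [← ht] at hsys
    have hlast : v (Fin.last _) ^ 2 = (q + 1) * t - q := by
      have h1 := hv1
      simp only [dotProduct_succ, ← pow_two, (hsys _).1, Finset.sum_const, Finset.card_univ,
        Fintype.card_fin, nsmul_eq_mul] at h1
      push_cast at h1
      linear_combination h1
    have hplast : p (Fin.last _) ^ 2 = 4 - t - 9 / 16 * t ^ 2 := by
      have h1 := ht
      simp only [dotProduct_succ, (hsys _).2, mul_ite, mul_zero, Finset.sum_ite_eq',
        Finset.mem_univ, if_true] at h1
      linear_combination h1
    have hvplast : v (Fin.last _) * p (Fin.last _) = -(3 / 4 * t * v (Fin.castSucc 0)) := by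
      have h1 := hv2
      simp only [dotProduct_succ, (hsys _).2, mul_ite, mul_zero, Finset.sum_ite_eq',
        Finset.mem_univ, if_true] at h1
      linear_combination h1
    have hcubic : tangentCubic q t = 0 := by
      have h1 := congrArg (· ^ 2) hvplast
      simp only [mul_pow, hlast, hplast, neg_sq, (hsys 0).1] at h1
      unfold tangentCubic
      linear_combination -h1
    obtain ⟨i, rfl⟩ := (hk t).1 hcubic
    obtain ⟨w, hw, hwlast⟩ : ∃ w, (w = v ∨ w = -v) ∧ w (Fin.last _) = d i := by
      rw [← hd i, sq_eq_sq_iff_eq_or_eq_neg] at hlast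
      rcases hlast with h | h
      · exact ⟨v, Or.inl rfl, h⟩
      · exact ⟨-v, Or.inr rfl, by simp [h]⟩
    have hline : lineThrough p v = lineThrough p w := by
      rcases hw with rfl | rfl
      · rfl
      · rw [lineThrough, lineThrough, ← Set.neg_singleton, Submodule.span_neg]
    have hwsq : ∀ j : Fin (q + 1), w j.castSucc ^ 2 = a i ^ 2 := by
      intro j
      rw [ha]
      rcases hw with rfl | rfl <;> simp [(hsys j).1]
    have hwp : d i * p (Fin.last _) = -(3 / 4 * k i * w (Fin.castSucc 0)) := by
      rw [← hwlast]
      rcases hw with rfl | rfl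
      · exact hvplast
      · simp only [Pi.neg_apply]
        linear_combination -hvplast
    have hsign : ∀ j : Fin (q + 1), ∃ s, w j.castSucc = boolSign s * a i := by
      intro j
      rcases sq_eq_sq_iff_eq_or_eq_neg.1 (hwsq j) with h | h
      · exact ⟨true, by simp [boolSign, h]⟩
      · exact ⟨false, by simp [boolSign, h]⟩
    choose σ hσ using hsign
    refine ⟨(i, σ), ?_⟩
    have hweq : signedDirection (a i) (d i) σ = w := by
      funext l
      induction l using Fin.lastCases with
      | last => simp [signedDirection, hwlast]
      | cast j => simp [signedDirection, hσ]
    have hpeq : footPoint (k i) (a i) (d i) σ = p := by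
      funext l
      induction l using Fin.lastCases with
      | last =>
        simp only [footPoint, Fin.snoc_last]
        rw [← hσ, ← hwp, mul_div_cancel_left₀ _ (hd0 i)]
      | cast j => simp only [footPoint, Fin.snoc_castSucc, (hsys j).2]
    simp only [hweq, hpeq, hline]

end Lines

/-- for every `n ≥ 4` there are `2n−2` spheres of equal radius `r` in `ℝⁿ`
whose centers all lie in a common affine hyperplane `{x | w·x = b}` (so in particular are
affinely dependent), having exactly `3·2^{n−1}` complex common tangent lines. -/
theorem exists_affinely_dependent_config (n : ℕ) (hn : 4 ≤ n) :
    ∃ (c : Fin (2 * n - 2) → (Fin n → ℝ)) (r : ℝ) (w : Fin n → ℝ) (b : ℝ),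
      0 < r ∧ w ≠ 0 ∧ (∀ i, ∑ j, w j * c i j = b) ∧
      (({L | Module.finrank ℂ L.direction = 1 ∧
          ∀ i, IsTangentLine L (fun j => (c i j : ℂ)) r} :
            Set (AffineSubspace ℂ (Fin n → ℂ))).Finite) ∧
      (({L | Module.finrank ℂ L.direction = 1 ∧
          ∀ i, IsTangentLine L (fun j => (c i j : ℂ)) r} :
            Set (AffineSubspace ℂ (Fin n → ℂ))).ncard = 3 * 2 ^ (n - 1)) := by
  obtain ⟨q, rfl⟩ : ∃ q, n = q + 2 := ⟨n - 2, by omega⟩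
  have hcard : Fintype.card (Fin (2 * (q + 2) - 2)) = Fintype.card (Fin (q + 1) × Bool) := by
    simp only [Fintype.card_fin, Fintype.card_prod, Fintype.card_bool]
    omega
  have e := Fintype.equivOfCardEq hcard
  obtain ⟨F, hF, hrange⟩ := exists_parametrization_tangentLines (q := q) (by omega)
  have hset : {L : AffineSubspace ℂ (Fin (q + 2) → ℂ) | Module.finrank ℂ L.direction = 1 ∧
      ∀ i, IsTangentLine L (fun j => (axisCenter (e i).1 (e i).2 j : ℂ)) 2} = Set.range F := by
    rw [hrange]
    ext L
    refine and_congr_right fun _ => ?_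
    rw [← Prod.forall (p := fun x => IsTangentLine L (fun i => ((axisCenter x.1 x.2 i : ℝ) : ℂ)) 2)]
    exact e.forall_congr_left.trans (by simp)
  refine ⟨fun i => axisCenter (e i).1 (e i).2, 2, Pi.single (Fin.last _) 1, 0, two_pos,
    by simp, fun i => ?_, ?_, ?_⟩
  · refine Finset.sum_eq_zero fun j _ => ?_
    induction j using Fin.lastCases with
    | last => simp [axisCenter]
    | cast j => simp
  · rw [hset]
    exact Set.finite_range F
  · rw [hset, ← Set.image_univ, Set.ncard_image_of_injective _ hF, Set.ncard_univ,
      Nat.card_eq_fintype_card]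
    simp
end
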